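/- arXiv:2605.04660 — 2 statements merged into one kernel-verified Lean document; each statement's English description precedes it below -/
import Mathlib

section
/- (Midpoint-corrected trapezoidal rule error, eq. (error_edge) of Appendix A.) Let f : ℝ → ℝ be four times continuously differentiable. Then for all real numbers a ≤ b: |∫_a^b f(x) dx − (b − a)·(f(a) + f(b))/2 + ((b − a)³/12)·f''((a + b)/2)| ≤ ((b − a)⁵/320)·sup_{x ∈ [a,b]} |f⁗(x)|, where f'' and f⁗ denote the second and fourth derivatives of f (the supremum is attained since f⁗ is continuous on the compact interval [a,b]). -/
/-- A function vanishing at `0` whose derivative is bounded by `(n + 1) * C * t ^ n` on `[0, T]`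
is bounded by `C * t ^ (n + 1)` there. -/
lemma abs_le_mul_pow_succ_of_abs_deriv_le {F F' : ℝ → ℝ} {C T : ℝ} (n : ℕ) (h0 : F 0 = 0)
    (hF : ∀ t, HasDerivAt F (F' t) t)
    (hb : ∀ t ∈ Set.Icc 0 T, |F' t| ≤ (n + 1) * C * t ^ n) :
    ∀ t ∈ Set.Icc 0 T, |F t| ≤ C * t ^ (n + 1) := by
  have hB (t : ℝ) : HasDerivAt (fun t : ℝ => C * t ^ (n + 1)) ((n + 1) * C * t ^ n) t := by
    refine ((hasDerivAt_pow (n + 1) t).const_mul C).congr_deriv ?_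
    push_cast
    ring
  intro t ht
  exact image_norm_le_of_norm_deriv_right_le_deriv_boundary
    (fun t _ => (hF t).continuousAt.continuousWithinAt)
    (fun t _ => (hF t).hasDerivWithinAt) (by simp [h0]) hB
    (fun t ht => hb t (Set.Ico_subset_Icc_self ht)) ht

lemma ContDiff.hasDerivAt_iteratedDeriv {f : ℝ → ℝ} {n : WithTop ℕ∞} (hf : ContDiff ℝ n f)
    (k : ℕ) (hk : (k : WithTop ℕ∞) < n) (x : ℝ) :
    HasDerivAt (iteratedDeriv k f) (iteratedDeriv (k + 1) f x) x := by
  rw [iteratedDeriv_succ]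
  exact (hf.differentiable_iteratedDeriv k hk x).hasDerivAt

/-- The midpoint-corrected trapezoidal rule on `[m - T, m + T]` for a function whose fourth
derivative is bounded by `M`. -/
lemma abs_symmetric_trapezoid_error_le {f : ℝ → ℝ} (hf : ContDiff ℝ 4 f) {m T M : ℝ} (hT : 0 ≤ T)
    (hM : ∀ x ∈ Set.Icc (m - T) (m + T), |iteratedDeriv 4 f x| ≤ M) :
    |(∫ x in (m - T)..(m + T), f x) - T * (f (m + T) + f (m - T))
      + 2 / 3 * T ^ 3 * iteratedDeriv 2 f m| ≤ M / 15 * T ^ 5 := by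
  have hplus {g : ℝ → ℝ} {g' t : ℝ} (h : HasDerivAt g g' (m + t)) :
      HasDerivAt (fun t => g (m + t)) g' t := h.comp_const_add m t
  have hminus {g : ℝ → ℝ} {g' t : ℝ} (h : HasDerivAt g g' (m - t)) :
      HasDerivAt (fun t => g (m - t)) (-g') t := h.comp_const_sub m t
  have hd0 (x : ℝ) : HasDerivAt f (iteratedDeriv 1 f x) x := by
    simpa using hf.hasDerivAt_iteratedDeriv 0 (by norm_num) x
  have hd1 := hf.hasDerivAt_iteratedDeriv 1 (by norm_num)
  have hd2 := hf.hasDerivAt_iteratedDeriv 2 (by norm_num)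
  have hd3 := hf.hasDerivAt_iteratedDeriv 3 (by norm_num)
  have third : ∀ t ∈ Set.Icc 0 T,
      |iteratedDeriv 3 f (m + t) - iteratedDeriv 3 f (m - t)| ≤ 2 * M * t ^ (0 + 1) := by
    refine abs_le_mul_pow_succ_of_abs_deriv_le 0 (by simp)
      (fun t => (hplus (hd3 _)).sub (hminus (hd3 _))) fun t ht => ?_
    have h₁ := abs_le.1 (hM (m + t) ⟨by linarith [ht.1], by linarith [ht.2]⟩)
    have h₂ := abs_le.1 (hM (m - t) ⟨by linarith [ht.2], by linarith [ht.1]⟩)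
    norm_num at h₁ h₂ ⊢
    rw [abs_le]
    constructor <;> linarith
  have second : ∀ t ∈ Set.Icc 0 T,
      |iteratedDeriv 2 f (m + t) + iteratedDeriv 2 f (m - t) - 2 * iteratedDeriv 2 f m|
        ≤ M * t ^ (1 + 1) := by
    refine abs_le_mul_pow_succ_of_abs_deriv_le 1 (by simp; ring)
      (fun t => ((hplus (hd2 _)).add (hminus (hd2 _))).sub_const _) fun t ht => ?_
    rw [← sub_eq_add_neg]
    refine (third t ht).trans_eq ?_
    norm_num
  have first : ∀ t ∈ Set.Icc 0 T,
      |iteratedDeriv 1 f (m + t) - iteratedDeriv 1 f (m - t) - t * (2 * iteratedDeriv 2 f m)|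
        ≤ M / 3 * t ^ (2 + 1) := by
    refine abs_le_mul_pow_succ_of_abs_deriv_le 2 (by simp)
      (fun t => ((hplus (hd1 _)).sub (hminus (hd1 _))).sub
        ((hasDerivAt_id t).mul_const _)) fun t ht => ?_
    rw [sub_neg_eq_add, one_mul]
    refine (second t ht).trans_eq ?_
    push_cast
    ring
  have hprimitive (x : ℝ) : HasDerivAt (fun x => ∫ y in m..x, f y) (f x) x :=
    intervalIntegral.integral_hasDerivAt_right (hf.continuous.intervalIntegrable _ _)
      (hf.continuous.stronglyMeasurableAtFilter _ _) hf.continuous.continuousAt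
  have hderiv (t : ℝ) : HasDerivAt
      (fun t => (∫ x in m..(m + t), f x) - (∫ x in m..(m - t), f x)
        - t * (f (m + t) + f (m - t)) + 2 / 3 * t ^ 3 * iteratedDeriv 2 f m)
      (-(t * (iteratedDeriv 1 f (m + t) - iteratedDeriv 1 f (m - t)
        - t * (2 * iteratedDeriv 2 f m)))) t := by
    refine ((((hplus (hprimitive _)).sub (hminus (hprimitive _))).sub
      ((hasDerivAt_id' t).fun_mul ((hplus (hd0 _)).fun_add (hminus (hd0 _))))).add
      (((hasDerivAt_pow 3 t).const_mul (2 / 3)).mul_const _)).congr_deriv ?_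
    norm_num
    ring
  have key := abs_le_mul_pow_succ_of_abs_deriv_le (C := M / 15) (T := T) 4 (by simp) hderiv
    (fun t ht => by
      rw [abs_neg, abs_mul, abs_of_nonneg ht.1]
      refine (mul_le_mul_of_nonneg_left (first t ht) ht.1).trans_eq ?_
      norm_num
      ring)
    T ⟨hT, le_rfl⟩
  rw [← intervalIntegral.integral_interval_sub_left (a := m)
    (hf.continuous.intervalIntegrable _ _) (hf.continuous.intervalIntegrable _ _)]
  simpa using key

/-- Midpoint-corrected trapezoidal rule error, eq. (error_edge) of Appendix A:
for a `C⁴` function the trapezoidal rule corrected by the midpoint second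
derivative has error bounded by `((b−a)⁵/320)·sup_{[a,b]} |f⁗|`. -/
theorem corrected_trapezoid_error
    (f : ℝ → ℝ) (hf : ContDiff ℝ 4 f) :
    ∀ a b : ℝ, a ≤ b →
      |(∫ x in a..b, f x) - (b - a) * (f a + f b) / 2
        + ((b - a) ^ 3 / 12) * iteratedDeriv 2 f ((a + b) / 2)|
      ≤ ((b - a) ^ 5 / 320) * ⨆ x : Set.Icc a b, |iteratedDeriv 4 f x| := by
  intro a b hab
  set M := ⨆ x : Set.Icc a b, |iteratedDeriv 4 f x|
  have hcont : Continuous fun x : Set.Icc a b => |iteratedDeriv 4 f x| :=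
    ((hf.continuous_iteratedDeriv 4 le_rfl).comp continuous_subtype_val).abs
  have hM : ∀ x ∈ Set.Icc a b, |iteratedDeriv 4 f x| ≤ M := fun x hx =>
    le_ciSup (isCompact_range hcont).bddAbove (⟨x, hx⟩ : Set.Icc a b)
  have hM0 : 0 ≤ M := Real.iSup_nonneg fun _ => abs_nonneg _
  have hl : (a + b) / 2 - (b - a) / 2 = a := by ring
  have hr : (a + b) / 2 + (b - a) / 2 = b := by ring
  have h := abs_symmetric_trapezoid_error_le hf (m := (a + b) / 2) (T := (b - a) / 2) (M := M)
    (by linarith) (by rwa [hl, hr])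
  rw [hl, hr] at h
  calc
    _ = |(∫ x in a..b, f x) - (b - a) / 2 * (f b + f a)
          + 2 / 3 * ((b - a) / 2) ^ 3 * iteratedDeriv 2 f ((a + b) / 2)| := by
      congr 1
      ring
    _ ≤ M / 15 * ((b - a) / 2) ^ 5 := h
    _ ≤ (b - a) ^ 5 / 320 * M := by
      have : 0 ≤ (b - a) ^ 5 * M := mul_nonneg (pow_nonneg (sub_nonneg.2 hab) 5) hM0
      linarith
end

section
/- (Chord-direction stability; Lemma 'Geometric properties of M_h', item 3, of Appendix A.) Let K ⊆ ℝ² be a compact convex set, let φ : ℝ² → ℝ² be twice continuously differentiable, and let c > 0 satisfy ‖Dφ(y) u‖ ≥ c‖u‖ for all y ∈ K and u ∈ ℝ². Fix a nonzero direction d ∈ ℝ². Then there exist constants C > 0 and h₀ > 0 such that for every h with 0 < h ≤ h₀, every shift vector b ∈ ℝ² with ‖b‖ ≤ h, and every x ∈ ℝ² with x, x + h·d, x + b, x + b + h·d ∈ K: the chords φ(x + h·d) − φ(x) and φ(x + b + h·d) − φ(x + b) are nonzero, and the corresponding unit vectors satisfy ‖(φ(x + b + h·d) − φ(x + b))/‖φ(x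 + b + h·d) − φ(x + b)‖ − (φ(x + h·d) − φ(x))/‖φ(x + h·d) − φ(x)‖‖ ≤ C·h. -/
/-- Normalization is Lipschitz away from the origin. -/
lemma norm_inv_norm_smul_sub_le {E : Type*} [NormedAddCommGroup E] [NormedSpace ℝ E]
    {p q : E} (hp : p ≠ 0) (hq : q ≠ 0) :
    ‖‖p‖⁻¹ • p - ‖q‖⁻¹ • q‖ ≤ 2 * ‖p - q‖ / ‖p‖ := by
  have hp' : 0 < ‖p‖ := norm_pos_iff.2 hp
  have hq' : 0 < ‖q‖ := norm_pos_iff.2 hq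
  have key : ‖p‖ • (‖p‖⁻¹ • p - ‖q‖⁻¹ • q) = (p - q) + (‖q‖ - ‖p‖) • (‖q‖⁻¹ • q) := by
    rw [smul_sub, sub_smul, smul_inv_smul₀ hp'.ne', smul_inv_smul₀ hq'.ne']
    abel
  have hunit : ‖‖q‖⁻¹ • q‖ = 1 := by
    rw [norm_smul, norm_inv, norm_norm, inv_mul_cancel₀ hq'.ne']
  have hsub : |‖q‖ - ‖p‖| ≤ ‖p - q‖ := by
    rw [abs_sub_comm]
    exact abs_norm_sub_norm_le p q
  rw [le_div_iff₀ hp', mul_comm, ← norm_norm p, ← norm_smul, norm_norm, key]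
  refine (norm_add_le _ _).trans ?_
  rw [norm_smul, hunit, mul_one, Real.norm_eq_abs]
  linarith

/-- The derivative of a `C²` map is Lipschitz on a compact convex set. -/
lemma ContDiff.exists_norm_fderiv_sub_le {E F : Type*} [NormedAddCommGroup E] [NormedSpace ℝ E]
    [NormedAddCommGroup F] [NormedSpace ℝ F] {φ : E → F} (hφ : ContDiff ℝ 2 φ)
    {K : Set E} (hK : IsCompact K) (hKc : Convex ℝ K) :
    ∃ L > 0, ∀ y ∈ K, ∀ z ∈ K, ‖fderiv ℝ φ z - fderiv ℝ φ y‖ ≤ L * ‖z - y‖ := by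
  have h1 : ContDiff ℝ 1 (fderiv ℝ φ) := hφ.fderiv_right (by norm_num)
  obtain ⟨L, hL⟩ := hK.exists_bound_of_continuousOn
    (h1.continuous_fderiv one_ne_zero).continuousOn
  refine ⟨max L 1, by positivity, fun y hy z hz => ?_⟩
  exact hKc.norm_image_sub_le_of_norm_fderiv_le
    (fun w _ => (h1.differentiable one_ne_zero) w)
    (fun w hw => (hL w hw).trans (le_max_left _ _)) hy hz

/-- A chord of `φ` is approximated by the derivative at a nearby point when the derivative
is Lipschitz. -/
lemma norm_chord_sub_fderiv_le {E F : Type*} [NormedAddCommGroup E] [NormedSpace ℝ E]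
    [NormedAddCommGroup F] [NormedSpace ℝ F] {φ : E → F} (hφ : Differentiable ℝ φ)
    {K : Set E} (hKc : Convex ℝ K) {L : ℝ} (hL : 0 ≤ L)
    (hLip : ∀ y ∈ K, ∀ z ∈ K, ‖fderiv ℝ φ z - fderiv ℝ φ y‖ ≤ L * ‖z - y‖)
    {x b v : E} (hx : x ∈ K) (hb : x + b ∈ K) (hbv : x + b + v ∈ K) :
    ‖φ (x + b + v) - φ (x + b) - fderiv ℝ φ x v‖ ≤ L * (‖b‖ + ‖v‖) * ‖v‖ := by
  have hseg : ∀ z ∈ segment ℝ (x + b) (x + b + v),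
      ‖fderiv ℝ φ z - fderiv ℝ φ x‖ ≤ L * (‖b‖ + ‖v‖) := by
    intro z hz
    refine (hLip x hx z (hKc.segment_subset hb hbv hz)).trans ?_
    gcongr
    rw [segment_eq_image'] at hz
    obtain ⟨t, ⟨ht0, ht1⟩, rfl⟩ := hz
    have heq : x + b + t • (x + b + v - (x + b)) - x = b + t • v := by
      rw [add_sub_cancel_left]
      abel
    simp only [heq]
    refine (norm_add_le _ _).trans ?_
    gcongr
    rw [norm_smul, Real.norm_of_nonneg ht0]
    exact mul_le_of_le_one_left (norm_nonneg v) ht1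
  simpa only [add_sub_cancel_left] using
    (convex_segment (𝕜 := ℝ) (x + b) (x + b + v)).norm_image_sub_le_of_norm_fderiv_le'
      (fun z _ => hφ z) hseg (left_mem_segment ℝ _ _) (right_mem_segment ℝ _ _)

/-- Chord-direction stability (Lemma "Geometric properties of `M_h`", item 3,
Appendix A): for a `C²` map `φ` whose derivative is uniformly injective on a
compact convex set `K`, the unit directions of the chords `φ(x+h•d) − φ(x)`
and `φ(x+b+h•d) − φ(x+b)` differ by at most `C·h` whenever `‖b‖ ≤ h`. -/
theorem chord_direction_stability
    (K : Set (EuclideanSpace ℝ (Fin 2))) (hK : IsCompact K) (hKc : Convex ℝ K)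
    (φ : EuclideanSpace ℝ (Fin 2) → EuclideanSpace ℝ (Fin 2))
    (hφ : ContDiff ℝ 2 φ) (c : ℝ) (hc : 0 < c)
    (hlow : ∀ y ∈ K, ∀ u : EuclideanSpace ℝ (Fin 2), c * ‖u‖ ≤ ‖fderiv ℝ φ y u‖)
    (d : EuclideanSpace ℝ (Fin 2)) (hd : d ≠ 0) :
    ∃ C > 0, ∃ h₀ > 0, ∀ h : ℝ, 0 < h → h ≤ h₀ →
      ∀ b : EuclideanSpace ℝ (Fin 2), ‖b‖ ≤ h →
      ∀ x : EuclideanSpace ℝ (Fin 2),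
        x ∈ K → x + h • d ∈ K → x + b ∈ K → x + b + h • d ∈ K →
        φ (x + h • d) - φ x ≠ 0 ∧ φ (x + b + h • d) - φ (x + b) ≠ 0 ∧
        ‖‖φ (x + b + h • d) - φ (x + b)‖⁻¹ • (φ (x + b + h • d) - φ (x + b))
          - ‖φ (x + h • d) - φ x‖⁻¹ • (φ (x + h • d) - φ x)‖ ≤ C * h := by
  obtain ⟨L, hL, hLip⟩ := hφ.exists_norm_fderiv_sub_le hK hKc
  have hdiff : Differentiable ℝ φ := hφ.differentiable two_ne_zero
  have hD : 0 < ‖d‖ := norm_pos_iff.2 hd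
  refine ⟨8 * L * (1 + ‖d‖) / c, by positivity, c / (2 * L * (1 + ‖d‖)), by positivity, ?_⟩
  intro h hh hh0 b hb x hx hxd hxb hxbd
  have hv : ‖h • d‖ = h * ‖d‖ := by rw [norm_smul, Real.norm_of_nonneg hh.le]
  rw [le_div_iff₀ (by positivity)] at hh0
  have chord : ∀ b' : EuclideanSpace ℝ (Fin 2), ‖b'‖ ≤ h → x + b' ∈ K → x + b' + h • d ∈ K →
      ‖φ (x + b' + h • d) - φ (x + b') - fderiv ℝ φ x (h • d)‖
        ≤ L * (h + h * ‖d‖) * (h * ‖d‖) := by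
    intro b' hb' h1 h2
    refine (norm_chord_sub_fderiv_le hdiff hKc hL.le hLip hx h1 h2).trans ?_
    rw [hv]
    gcongr
  have hp := chord b hb hxb hxbd
  have hq := chord 0 (by simpa using hh.le) (by simpa using hx) (by simpa using hxd)
  rw [add_zero] at hq
  have hA := hlow x hx (h • d)
  rw [hv] at hA
  set p := φ (x + b + h • d) - φ (x + b)
  set q := φ (x + h • d) - φ x
  set a := fderiv ℝ φ x (h • d)
  have hsmall : L * (h + h * ‖d‖) * (h * ‖d‖) ≤ c / 2 * (h * ‖d‖) := by
    gcongr
    linarith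
  have lower : ∀ r : EuclideanSpace ℝ (Fin 2), ‖r - a‖ ≤ L * (h + h * ‖d‖) * (h * ‖d‖) →
      c / 2 * (h * ‖d‖) ≤ ‖r‖ := by
    intro r hr
    have := norm_sub_norm_le a r
    rw [norm_sub_rev] at this
    linarith
  have hpos : 0 < c / 2 * (h * ‖d‖) := by positivity
  have hp0 : p ≠ 0 := norm_pos_iff.1 (hpos.trans_le (lower p hp))
  have hq0 : q ≠ 0 := norm_pos_iff.1 (hpos.trans_le (lower q hq))
  have hpq : ‖p - q‖ ≤ 2 * (L * (h + h * ‖d‖) * (h * ‖d‖)) := by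
    have := norm_sub_le_norm_sub_add_norm_sub p a q
    rw [norm_sub_rev a q] at this
    linarith
  refine ⟨hq0, hp0, (norm_inv_norm_smul_sub_le hp0 hq0).trans ?_⟩
  calc 2 * ‖p - q‖ / ‖p‖
      ≤ 2 * (2 * (L * (h + h * ‖d‖) * (h * ‖d‖))) / (c / 2 * (h * ‖d‖)) := by
        gcongr
        exact lower p hp
    _ = 8 * L * (1 + ‖d‖) / c * h := by
        field_simp
        ring
end
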